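/- arXiv:1509.00271 — 4 statements merged into one kernel-verified Lean document; each statement's English description precedes it below -/
import Mathlib

section
/- Let 𝕜 be a field and t ∈ 𝕜. In the polynomial ring 𝕜[X,Y,Z] consider the homogeneous polynomials f₀ = t·Y² − X·Z, f₁ = Y·Z and f₂ = Z². If t ≠ 0, then every common divisor of f₀, f₁ and f₂ is a unit; if t = 0, then Z divides each of f₀, f₁ and f₂. -/
open MvPolynomial

/-- In `𝕜[X,Y,Z]`, for `f₀ = t·Y² − X·Z`, `f₁ = Y·Z`, `f₂ = Z²`:
if `t ≠ 0` then every common divisor of `f₀, f₁, f₂` is a unit;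
if `t = 0` then `Z` divides each of `f₀, f₁, f₂`. -/
theorem stmt_1 {𝕜 : Type*} [Field 𝕜] (t : 𝕜)
    (f₀ f₁ f₂ : MvPolynomial (Fin 3) 𝕜)
    (h₀ : f₀ = C t * X 1 ^ 2 - X 0 * X 2)
    (h₁ : f₁ = X 1 * X 2)
    (h₂ : f₂ = X 2 ^ 2) :
    (t ≠ 0 → ∀ d : MvPolynomial (Fin 3) 𝕜, d ∣ f₀ → d ∣ f₁ → d ∣ f₂ → IsUnit d) ∧
    (t = 0 → X 2 ∣ f₀ ∧ X 2 ∣ f₁ ∧ X 2 ∣ f₂) := by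
  subst h₀ h₁ h₂
  refine ⟨fun ht d hd₀ _ hd₂ ↦ ?_, ?_⟩
  · have hp : Prime (X 2 : MvPolynomial (Fin 3) 𝕜) := X_prime
    obtain ⟨i, -, hi⟩ := (dvd_prime_pow hp 2).mp hd₂
    rcases eq_or_ne i 0 with rfl | hi₀
    · exact associated_one_iff_isUnit.mp (by simpa using hi)
    · have hZ : (X 2 : MvPolynomial (Fin 3) 𝕜) ∣ C t * X 1 ^ 2 :=
        (dvd_sub_left (dvd_mul_left _ _)).mp
          (((dvd_pow_self _ hi₀).trans hi.symm.dvd).trans hd₀)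
      rcases hp.dvd_or_dvd hZ with h | h
      · exact absurd (isUnit_of_dvd_unit h (ht.isUnit.map C)) hp.not_isUnit
      · exact absurd (X_dvd_X.mp (hp.dvd_of_dvd_pow h)) (by decide)
  · rintro rfl
    exact ⟨by simp, dvd_mul_left _ _, dvd_pow_self _ two_ne_zero⟩
end

section
/- Let 𝕜 be a field and (a,b,c) ∈ 𝕜³ with (a,b) ≠ (0,0) and (a,c) ≠ (0,0). Then aY+b and aY+c are nonzero elements of K, and there exists a 𝕜-algebra automorphism φ of K with φ(X) = X·(aY+b)/(aY+c) and φ(Y) = Y; moreover its inverse satisfies φ⁻¹(X) = X·(aY+c)/(aY+b) and φ⁻¹(Y) = Y. -/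
theorem AlgebraicIndependent.update_mul {ι R L : Type*} [CommRing R] [Field L] [Algebra R L]
    [DecidableEq ι] {v : ι → L} (hv : AlgebraicIndependent R v) (i : ι) {u : L} (hu : u ≠ 0)
    (hu_alg : IsAlgebraic (Algebra.adjoin R (v '' {i}ᶜ)) u) :
    AlgebraicIndependent R (Function.update v i (v i * u)) := by
  have himage : Function.update v i (v i * u) '' {i}ᶜ = v '' {i}ᶜ :=
    Set.image_congr fun j hj ↦ Function.update_of_ne hj _ _
  have hrestrict : (fun j : {j // j ≠ i} ↦ Function.update v i (v i * u) j) =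
      fun j : {j // j ≠ i} ↦ v j :=
    funext fun j ↦ Function.update_of_ne j.2 _ _
  rw [AlgebraicIndependent.iff_transcendental_adjoin_image i] at hv ⊢
  rw [himage, hrestrict, Function.update_self]
  refine ⟨hv.1, fun h ↦ hv.2 ?_⟩
  simpa [mul_assoc, hu] using h.mul hu_alg.inv

section FunctionField

open MvPolynomial

variable {𝕜 : Type*} [Field 𝕜] {K : Type*} [Field K] [Algebra (MvPolynomial (Fin 2) 𝕜) K]
  [IsFractionRing (MvPolynomial (Fin 2) 𝕜) K] [Algebra 𝕜 K]
  [IsScalarTower 𝕜 (MvPolynomial (Fin 2) 𝕜) K]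

variable (𝕜 K) in
theorem algebraicIndependent_algebraMap_X :
    AlgebraicIndependent 𝕜 fun i : Fin 2 ↦ algebraMap (MvPolynomial (Fin 2) 𝕜) K (X i) :=
  (algebraicIndependent_X (Fin 2) 𝕜).map' (f := IsScalarTower.toAlgHom 𝕜 _ K)
    (IsFractionRing.injective _ K)

theorem algHom_ext_of_X {f g : K →ₐ[𝕜] K}
    (h : ∀ i, f (algebraMap (MvPolynomial (Fin 2) 𝕜) K (X i)) =
      g (algebraMap (MvPolynomial (Fin 2) 𝕜) K (X i))) : f = g := by
  have hcomp : f.comp (IsScalarTower.toAlgHom 𝕜 (MvPolynomial (Fin 2) 𝕜) K) =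
      g.comp (IsScalarTower.toAlgHom 𝕜 (MvPolynomial (Fin 2) 𝕜) K) :=
    MvPolynomial.algHom_ext h
  have hring : (f : K →+* K) = g :=
    IsFractionRing.ringHom_ext (A := MvPolynomial (Fin 2) 𝕜) fun p ↦ DFunLike.congr_fun hcomp p
  exact AlgHom.coe_ringHom_injective hring

theorem linear_ne_zero {a b : 𝕜} (hab : (a, b) ≠ (0, 0)) :
    algebraMap 𝕜 K a * algebraMap (MvPolynomial (Fin 2) 𝕜) K (X 1) + algebraMap 𝕜 K b ≠ 0 := by
  intro h
  have hp : (C a * X 1 + C b : MvPolynomial (Fin 2) 𝕜) = 0 := by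
    apply algebraicIndependent_iff.mp (algebraicIndependent_algebraMap_X 𝕜 K)
    simpa using h
  have hb : b = 0 := by simpa using congrArg (eval 0) hp
  have ha : a = 0 := by simpa [hb] using congrArg (eval 1) hp
  exact hab (by rw [ha, hb])

/-- A nonzero `u` algebraic over `𝕜[Y]` defines an endomorphism `X ↦ X * u`, `Y ↦ Y`. -/
theorem exists_algHom_scale_X {u : K} (hu : u ≠ 0)
    (hu_alg : IsAlgebraic
      (Algebra.adjoin 𝕜 {algebraMap (MvPolynomial (Fin 2) 𝕜) K (X 1)}) u) :
    ∃ f : K →ₐ[𝕜] K,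
      f (algebraMap (MvPolynomial (Fin 2) 𝕜) K (X 0)) =
        algebraMap (MvPolynomial (Fin 2) 𝕜) K (X 0) * u ∧
      f (algebraMap (MvPolynomial (Fin 2) 𝕜) K (X 1)) =
        algebraMap (MvPolynomial (Fin 2) 𝕜) K (X 1) := by
  have hcompl : ({0}ᶜ : Set (Fin 2)) = {1} := by
    ext i
    fin_cases i <;> simp
  have hind := (algebraicIndependent_algebraMap_X 𝕜 K).update_mul 0 hu
    (by rwa [hcompl, Set.image_singleton])
  exact ⟨IsFractionRing.liftAlgHom hind,
    (IsLocalization.lift_eq _ _).trans (by simp), (IsLocalization.lift_eq _ _).trans (by simp)⟩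

end FunctionField

/-- Let `K` be the function field `𝕜(X,Y)` (fraction field of `𝕜[X,Y]`), with `x, y` the
images of the variables. If `(a,b) ≠ (0,0)` and `(a,c) ≠ (0,0)`, then `aY+b` and `aY+c`
are nonzero in `K`, and there is a `𝕜`-algebra automorphism `φ` of `K` with
`φ(X) = X·(aY+b)/(aY+c)`, `φ(Y) = Y`, whose inverse satisfies
`φ⁻¹(X) = X·(aY+c)/(aY+b)`, `φ⁻¹(Y) = Y`. -/
theorem stmt_2 {𝕜 : Type*} [Field 𝕜] (a b c : 𝕜)
    (hab : (a, b) ≠ (0, 0)) (hac : (a, c) ≠ (0, 0))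
    (K : Type*) [Field K] [Algebra (MvPolynomial (Fin 2) 𝕜) K]
    [IsFractionRing (MvPolynomial (Fin 2) 𝕜) K]
    [Algebra 𝕜 K] [IsScalarTower 𝕜 (MvPolynomial (Fin 2) 𝕜) K]
    (x y : K)
    (hx : x = algebraMap (MvPolynomial (Fin 2) 𝕜) K (MvPolynomial.X 0))
    (hy : y = algebraMap (MvPolynomial (Fin 2) 𝕜) K (MvPolynomial.X 1)) :
    algebraMap 𝕜 K a * y + algebraMap 𝕜 K b ≠ 0 ∧
    algebraMap 𝕜 K a * y + algebraMap 𝕜 K c ≠ 0 ∧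
    ∃ φ : K ≃ₐ[𝕜] K,
      φ x = x * (algebraMap 𝕜 K a * y + algebraMap 𝕜 K b) /
              (algebraMap 𝕜 K a * y + algebraMap 𝕜 K c) ∧
      φ y = y ∧
      φ.symm x = x * (algebraMap 𝕜 K a * y + algebraMap 𝕜 K c) /
              (algebraMap 𝕜 K a * y + algebraMap 𝕜 K b) ∧
      φ.symm y = y := by
  subst hx hy
  set x := algebraMap (MvPolynomial (Fin 2) 𝕜) K (MvPolynomial.X 0) with hx
  set y := algebraMap (MvPolynomial (Fin 2) 𝕜) K (MvPolynomial.X 1) with hy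
  have hb : algebraMap 𝕜 K a * y + algebraMap 𝕜 K b ≠ 0 := linear_ne_zero hab
  have hc : algebraMap 𝕜 K a * y + algebraMap 𝕜 K c ≠ 0 := linear_ne_zero hac
  refine ⟨hb, hc, ?_⟩
  have halg (d : 𝕜) :
      IsAlgebraic (Algebra.adjoin 𝕜 {y}) (algebraMap 𝕜 K a * y + algebraMap 𝕜 K d) :=
    isAlgebraic_algebraMap (⟨_, add_mem (mul_mem (Subalgebra.algebraMap_mem _ a)
      (Algebra.self_mem_adjoin_singleton 𝕜 y)) (Subalgebra.algebraMap_mem _ d)⟩ :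
        Algebra.adjoin 𝕜 {y})
  obtain ⟨f, hfx, hfy⟩ := exists_algHom_scale_X (mul_ne_zero hb (inv_ne_zero hc))
    ((halg b).mul (halg c).inv)
  obtain ⟨g, hgx, hgy⟩ := exists_algHom_scale_X (mul_ne_zero hc (inv_ne_zero hb))
    ((halg c).mul (halg b).inv)
  rw [← hx] at hfx hgx
  rw [← hy] at hfy hgy
  have hfg : f.comp g = AlgHom.id 𝕜 K := algHom_ext_of_X <| by
    rw [Fin.forall_fin_two, ← hx, ← hy]
    simp only [AlgHom.comp_apply, AlgHom.id_apply, hgx, hgy, hfx, hfy, map_mul, map_inv₀, map_add,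
      AlgHom.commutes, and_true]
    field_simp
  have hgf : g.comp f = AlgHom.id 𝕜 K := algHom_ext_of_X <| by
    rw [Fin.forall_fin_two, ← hx, ← hy]
    simp only [AlgHom.comp_apply, AlgHom.id_apply, hgx, hgy, hfx, hfy, map_mul, map_inv₀, map_add,
      AlgHom.commutes, and_true]
    field_simp
  exact ⟨AlgEquiv.ofAlgHom f g hfg hgf, by simp [hfx, div_eq_mul_inv, mul_assoc], hfy,
    by simp [hgx, div_eq_mul_inv, mul_assoc], hgy⟩
end

section
/- Let 𝕜 be a field and let (a,b,c), (a',b',c') ∈ 𝕜³ each satisfy (a,b) ≠ (0,0) and (a,c) ≠ (0,0), and assume b ≠ c and b' ≠ c'. Then X·(aY+b)/(aY+c) = X·(a'Y+b')/(a'Y+c') in K if and only if there exists λ ∈ 𝕜 with λ ≠ 0 and (a',b',c') = (λa, λb, λc). -/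
/-- The powers `1, y, y ^ 2` of a transcendental element are linearly independent. -/
theorem Transcendental.coeffs_eq_zero_of_quadratic {R A : Type*} [CommRing R] [CommRing A]
    [Algebra R A] {y : A} (hy : Transcendental R y) {p q r : R}
    (h : algebraMap R A p * y ^ 2 + algebraMap R A q * y + algebraMap R A r = 0) :
    p = 0 ∧ q = 0 ∧ r = 0 := by
  have h0 : Polynomial.C p * Polynomial.X ^ 2 + Polynomial.C q * Polynomial.X
      + Polynomial.C r = 0 :=
    transcendental_iff.mp hy _ (by simpa using h)
  refine ⟨?_, ?_, ?_⟩
  · simpa [Polynomial.coeff_X, Polynomial.coeff_C] using congrArg (Polynomial.coeff · 2) h0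
  · simpa [Polynomial.coeff_X, Polynomial.coeff_C] using congrArg (Polynomial.coeff · 1) h0
  · simpa using congrArg (Polynomial.coeff · 0) h0

/-- A nonzero linear form in a transcendental element does not vanish. -/
theorem Transcendental.linear_ne_zero {R A : Type*} [CommRing R] [CommRing A]
    [Algebra R A] {y : A} (hy : Transcendental R y) {p q : R} (hpq : (p, q) ≠ (0, 0)) :
    algebraMap R A p * y + algebraMap R A q ≠ 0 := by
  intro h
  obtain ⟨-, hp, hq⟩ := hy.coeffs_eq_zero_of_quadratic (p := 0) (q := p) (r := q) (by simpa using h)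
  exact hpq (by rw [hp, hq])


/-- In the function field `K = 𝕜(X,Y)`, for triples `(a,b,c)` and `(a',b',c')` with
`(a,b) ≠ (0,0)`, `(a,c) ≠ (0,0)`, `(a',b') ≠ (0,0)`, `(a',c') ≠ (0,0)`, `b ≠ c`, `b' ≠ c'`:
`X·(aY+b)/(aY+c) = X·(a'Y+b')/(a'Y+c')` holds if and only if there exists a nonzero
`λ ∈ 𝕜` with `(a',b',c') = (λa, λb, λc)`. -/
theorem stmt_4 {𝕜 : Type*} [Field 𝕜] (a b c a' b' c' : 𝕜)
    (hab : (a, b) ≠ (0, 0)) (hac : (a, c) ≠ (0, 0))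
    (hab' : (a', b') ≠ (0, 0)) (hac' : (a', c') ≠ (0, 0))
    (hbc : b ≠ c) (hbc' : b' ≠ c')
    (K : Type*) [Field K] [Algebra (MvPolynomial (Fin 2) 𝕜) K]
    [IsFractionRing (MvPolynomial (Fin 2) 𝕜) K]
    [Algebra 𝕜 K] [IsScalarTower 𝕜 (MvPolynomial (Fin 2) 𝕜) K]
    (x y : K)
    (hx : x = algebraMap (MvPolynomial (Fin 2) 𝕜) K (MvPolynomial.X 0))
    (hy : y = algebraMap (MvPolynomial (Fin 2) 𝕜) K (MvPolynomial.X 1)) :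
    x * (algebraMap 𝕜 K a * y + algebraMap 𝕜 K b) /
        (algebraMap 𝕜 K a * y + algebraMap 𝕜 K c) =
      x * (algebraMap 𝕜 K a' * y + algebraMap 𝕜 K b') /
        (algebraMap 𝕜 K a' * y + algebraMap 𝕜 K c') ↔
    ∃ l : 𝕜, l ≠ 0 ∧ a' = l * a ∧ b' = l * b ∧ c' = l * c := by
  have hinj := IsFractionRing.injective (MvPolynomial (Fin 2) 𝕜) K
  have hty : Transcendental 𝕜 y := by
    rw [hy, transcendental_algebraMap_iff hinj]
    exact MvPolynomial.transcendental_X 𝕜 1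
  have hx0 : x ≠ 0 := by
    rw [hx]
    exact (map_ne_zero_iff _ hinj).mpr (MvPolynomial.X_ne_zero 0)
  have hd := hty.linear_ne_zero hac
  have hd' := hty.linear_ne_zero hac'
  constructor
  · intro h
    rw [div_eq_div_iff hd hd', mul_assoc, mul_assoc] at h
    have h := mul_left_cancel₀ hx0 h
    obtain ⟨-, h1, h0⟩ := hty.coeffs_eq_zero_of_quadratic (p := 0)
      (q := a * c' + b * a' - (a' * c + b' * a)) (r := b * c' - b' * c) (by
        simp only [map_sub, map_add, map_mul, map_zero]
        linear_combination h)
    have hcb : c - b ≠ 0 := sub_ne_zero.mpr hbc.symm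
    refine ⟨(c' - b') / (c - b), div_ne_zero (sub_ne_zero.mpr hbc'.symm) hcb, ?_, ?_, ?_⟩ <;>
      rw [div_mul_eq_mul_div, eq_div_iff hcb]
    · linear_combination -h1
    · linear_combination -h0
    · linear_combination -h0
  · rintro ⟨l, hl, rfl, rfl, rfl⟩
    rw [div_eq_div_iff hd hd']
    simp only [map_mul]
    ring
end

section
/- Let 𝕜 be a field, m ≥ 1 an integer and a = (a₁,…,a_m) ∈ 𝕜^m. In the polynomial ring 𝕜[X,Y,Z] consider h₀ = X·Z^{m−1}, h₁ = Y·Z^{m−1} + ∑_{i=1}^m aᵢ·Xⁱ·Z^{m−i} and h₂ = Z^m. If a_m ≠ 0, then every common divisor of h₀, h₁ and h₂ is a unit; if a_m = 0 and m ≥ 2, then Z divides each of h₀, h₁ and h₂. -/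
open MvPolynomial

/-- In `𝕜[X,Y,Z]`, for `m ≥ 1` and `a = (a₁,…,a_m) ∈ 𝕜^m`, consider
`h₀ = X·Z^{m−1}`, `h₁ = Y·Z^{m−1} + ∑_{i=1}^m aᵢ·Xⁱ·Z^{m−i}`, `h₂ = Z^m`.
If `a_m ≠ 0` then every common divisor of `h₀, h₁, h₂` is a unit;
if `a_m = 0` and `m ≥ 2` then `Z` divides each of `h₀, h₁, h₂`. -/
theorem stmt_9 {𝕜 : Type*} [Field 𝕜] (m : ℕ) (hm : 1 ≤ m) (a : Fin m → 𝕜)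
    (h₀ h₁ h₂ : MvPolynomial (Fin 3) 𝕜)
    (e₀ : h₀ = X 0 * X 2 ^ (m - 1))
    (e₁ : h₁ = X 1 * X 2 ^ (m - 1) +
      ∑ i : Fin m, C (a i) * X 0 ^ ((i : ℕ) + 1) * X 2 ^ (m - ((i : ℕ) + 1)))
    (e₂ : h₂ = X 2 ^ m) :
    (a ⟨m - 1, by omega⟩ ≠ 0 →
      ∀ d : MvPolynomial (Fin 3) 𝕜, d ∣ h₀ → d ∣ h₁ → d ∣ h₂ → IsUnit d) ∧
    (a ⟨m - 1, by omega⟩ = 0 → 2 ≤ m → X 2 ∣ h₀ ∧ X 2 ∣ h₁ ∧ X 2 ∣ h₂) := by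
  subst e₀ e₁ e₂
  refine ⟨fun ha d _ hd₁ hd₂ => ?_, fun ha hm₂ => ⟨?_, ?_, ?_⟩⟩
  · obtain ⟨k, -, hk⟩ := (dvd_prime_pow (X_prime (i := (2 : Fin 3))) m).1 hd₂
    rcases Nat.eq_zero_or_pos k with rfl | hk_pos
    · exact associated_one_iff_isUnit.1 (by simpa using hk)
    · have hX := (dvd_pow_self (X 2) hk_pos.ne').trans (hk.dvd'.trans hd₁)
      have h := map_dvd (eval (![1, 0, 0] : Fin 3 → 𝕜)) hX
      simp only [map_add, map_mul, map_sum, map_pow, eval_X, eval_C] at h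
      rw [Finset.sum_eq_single (⟨m - 1, by omega⟩ : Fin m)] at h
      · exact absurd (by simpa [Nat.sub_add_cancel hm] using h) ha
      · intro i _ hi
        have : m - ((i : ℕ) + 1) ≠ 0 := fun h0 => hi (Fin.ext (by simp; omega))
        simp [this]
      · simp
  · exact (dvd_pow_self _ (by omega)).mul_left _
  · refine dvd_add ((dvd_pow_self _ (by omega)).mul_left _) (Finset.dvd_sum fun i _ => ?_)
    by_cases hi : i = ⟨m - 1, by omega⟩
    · simp [hi, ha]
    · have : m - ((i : ℕ) + 1) ≠ 0 := fun h0 => hi (Fin.ext (by simp; omega))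
      exact (dvd_pow_self _ this).mul_left _
  · exact dvd_pow_self _ (by omega)
end
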